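/- arXiv:1411.1822 — 10 statements merged into one kernel-verified Lean document; each statement's English description precedes it below -/
import Mathlib

section
/- Let C be a linear octonary code of length n, i.e. a ZMod 8-submodule of (Fin n → ZMod 8). Then the cardinality of C equals the cardinality of C⁽¹⁾ times the cardinality of C⁽³⁾, and also equals the cardinality of C⁽²⁾ times the cardinality of C⁽⁴⁾. -/
/-- Coordinatewise reduction mod 2 of an octonary vector. -/
def red2 {n : ℕ} (c : Fin n → ZMod 8) : Fin n → ZMod 2 :=
  fun i => ZMod.castHom (show (2 : ℕ) ∣ 8 by norm_num) (ZMod 2) (c i)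

/-- Coordinatewise reduction mod 4 of an octonary vector. -/
def red4 {n : ℕ} (c : Fin n → ZMod 8) : Fin n → ZMod 4 :=
  fun i => ZMod.castHom (show (4 : ℕ) ∣ 8 by norm_num) (ZMod 4) (c i)

/-- `μ₂ : ZMod 4 → ZMod 8`, sending `v` to `2·(an integer lift of v)`. -/
def mu2 (v : ZMod 4) : ZMod 8 := 2 * (v.val : ZMod 8)

/-- `μ₄ : ZMod 2 → ZMod 8`, sending `v` to `4·(an integer lift of v)`. -/
def mu4 (v : ZMod 2) : ZMod 8 := 4 * (v.val : ZMod 8)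

/-- The reduction code C⁽¹⁾. -/
def codeC1 {n : ℕ} (C : Set (Fin n → ZMod 8)) : Set (Fin n → ZMod 2) := red2 '' C

/-- The reduction code C⁽²⁾. -/
def codeC2 {n : ℕ} (C : Set (Fin n → ZMod 8)) : Set (Fin n → ZMod 4) := red4 '' C

/-- The torsion code C⁽³⁾. -/
def codeC3 {n : ℕ} (C : Set (Fin n → ZMod 8)) : Set (Fin n → ZMod 4) :=
  {v | (fun i => mu2 (v i)) ∈ C}

/-- The torsion code C⁽⁴⁾. -/
def codeC4 {n : ℕ} (C : Set (Fin n → ZMod 8)) : Set (Fin n → ZMod 2) :=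
  {v | (fun i => mu4 (v i)) ∈ C}

/-- Given an exact sequence `0 → D → A → B`, the cardinality of a subgroup of `A` is the product of
the cardinalities of its image in `B` and its preimage in `D`. -/
theorem AddSubgroup.card_eq_card_image_mul_card_preimage {A B D : Type*} [AddCommGroup A]
    [AddCommGroup B] [AddCommGroup D] (f : A →+ B) (g : D →+ A) (hg : Function.Injective g)
    (hfg : Function.Exact g f) (S : AddSubgroup A) :
    Nat.card S = Nat.card (f '' (S : Set A)) * Nat.card (g ⁻¹' (S : Set A)) := by
  have hker : Nat.card (f.comp S.subtype).ker = Nat.card (g ⁻¹' (S : Set A)) := by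
    symm
    refine Nat.card_eq_of_bijective
      (fun d => ⟨⟨g d, d.2⟩, hfg.apply_apply_eq_zero d⟩) ⟨fun a b h => ?_, ?_⟩
    · exact Subtype.ext (hg (congrArg (fun x => (x.1 : A)) h))
    · rintro ⟨⟨x, hx⟩, h⟩
      obtain ⟨d, rfl⟩ := (hfg x).1 h
      exact ⟨⟨d, hx⟩, rfl⟩
  have hrange : Nat.card (f.comp S.subtype).range = Nat.card (f '' (S : Set A)) := by
    rw [AddMonoidHom.range_comp, S.range_subtype]
    rfl
  rw [← hker, ← hrange, ← AddSubgroup.index_ker, mul_comm, AddSubgroup.card_mul_index]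

/-- Coordinatewise application of an exact sequence of additive maps is exact. -/
theorem Function.Exact.compLeft {A B D : Type*} [AddCommGroup A] [AddCommGroup B]
    [AddCommGroup D] {f : A →+ B} {g : D →+ A} (h : Function.Exact g f) (ι : Type*) :
    Function.Exact (g.compLeft ι) (f.compLeft ι) := by
  intro x
  constructor
  · intro hx
    choose d hd using fun i => (h (x i)).1 (congrFun hx i)
    exact ⟨d, funext hd⟩
  · rintro ⟨d, rfl⟩
    exact funext fun i => h.apply_apply_eq_zero (d i)

/-- `mu2` as an additive homomorphism. -/
def mu2Hom : ZMod 4 →+ ZMod 8 := AddMonoidHom.mk' mu2 (by decide)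

/-- `mu4` as an additive homomorphism. -/
def mu4Hom : ZMod 2 →+ ZMod 8 := AddMonoidHom.mk' mu4 (by decide)

theorem mu2Hom_injective : Function.Injective mu2Hom := by decide

theorem mu4Hom_injective : Function.Injective mu4Hom := by decide

theorem exact_mu2Hom_castHom : Function.Exact mu2Hom
    (ZMod.castHom (show (2 : ℕ) ∣ 8 by norm_num) (ZMod 2)).toAddMonoidHom := by
  unfold Function.Exact
  simp only [Set.mem_range]
  decide

theorem exact_mu4Hom_castHom : Function.Exact mu4Hom
    (ZMod.castHom (show (4 : ℕ) ∣ 8 by norm_num) (ZMod 4)).toAddMonoidHom := by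
  unfold Function.Exact
  simp only [Set.mem_range]
  decide

theorem card_eq_card_C1_mul_card_C3_and_card_C2_mul_card_C4
    (n : ℕ) (C : Submodule (ZMod 8) (Fin n → ZMod 8)) :
    Nat.card C = Nat.card (codeC1 (C : Set (Fin n → ZMod 8))) *
      Nat.card (codeC3 (C : Set (Fin n → ZMod 8))) ∧
    Nat.card C = Nat.card (codeC2 (C : Set (Fin n → ZMod 8))) *
      Nat.card (codeC4 (C : Set (Fin n → ZMod 8))) := by
  exact ⟨AddSubgroup.card_eq_card_image_mul_card_preimage _ _ mu2Hom_injective.comp_left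
      (exact_mu2Hom_castHom.compLeft (Fin n)) C.toAddSubgroup,
    AddSubgroup.card_eq_card_image_mul_card_preimage _ _ mu4Hom_injective.comp_left
      (exact_mu4Hom_castHom.compLeft (Fin n)) C.toAddSubgroup⟩
end

section
/- Let ι be a finite index type, let g : ι → (Fin n → ZMod 8) be a family of vectors, and let C be the ZMod 8-submodule of (Fin n → ZMod 8) spanned by the g i. Then C is self-orthogonal if and only if (1) for every i, writing ω_a for the number of coordinates j with (g i) j = a, one has ω₁ + ω₃ + ω₅ + ω₇ + 4ω₂ + 4ω₆ ≡ 0 (mod 8), i.e. the image of this natural number in ZMod 8 is 0, and (2) for every pair of distinct indices i ≠ j, ⟨g i, g j⟩ = 0. -/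
open Finset

/-- Dual of a code over `ZMod q` with respect to the standard inner product. -/
def dualCode {n q : ℕ} (D : Set (Fin n → ZMod q)) : Set (Fin n → ZMod q) :=
  {x | ∀ c ∈ D, ∑ i, x i * c i = 0}

/-- A code is self-orthogonal if it is contained in its dual. -/
def SelfOrthogonal {n q : ℕ} (D : Set (Fin n → ZMod q)) : Prop := D ⊆ dualCode D

/-- The number of coordinates of `x` equal to `a`. -/
def comp {n : ℕ} (x : Fin n → ZMod 8) (a : ZMod 8) : ℕ :=
  (univ.filter fun j => x j = a).card

/-- The span of a set is self-orthogonal iff the set is pairwise orthogonal. -/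
theorem selfOrthogonal_span_iff {n q : ℕ} (S : Set (Fin n → ZMod q)) :
    SelfOrthogonal (Submodule.span (ZMod q) S : Set (Fin n → ZMod q)) ↔
      ∀ x ∈ S, ∀ y ∈ S, ∑ k, x k * y k = 0 := by
  refine ⟨fun h x hx y hy => h (Submodule.subset_span hx) y (Submodule.subset_span hy),
    fun h x hx y hy => ?_⟩
  change x ⬝ᵥ y = 0
  induction hx, hy using Submodule.span_induction₂ with
  | mem_mem x y hx hy => exact h x hx y hy
  | zero_left y hy => exact zero_dotProduct y
  | zero_right x hx => exact dotProduct_zero x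
  | add_left x y z hx hy hz hxz hyz => rw [add_dotProduct, hxz, hyz, add_zero]
  | add_right x y z hx hy hz hxy hxz => rw [dotProduct_add, hxy, hxz, add_zero]
  | smul_left r x y hx hy hxy => rw [smul_dotProduct, hxy, smul_zero]
  | smul_right r x y hx hy hxy => rw [dotProduct_smul, hxy, smul_zero]

/-- The norm of an octonary vector in terms of its composition: the squares in `ZMod 8` are `1` at
odd elements, `4` at `2` and `6`, and `0` at `0` and `4`. -/
theorem sum_mul_self_eq_comp {n : ℕ} (x : Fin n → ZMod 8) :
    ∑ k, x k * x k = ((comp x 1 + comp x 3 + comp x 5 + comp x 7 +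
      4 * comp x 2 + 4 * comp x 6 : ℕ) : ZMod 8) := by
  have mul_self_eq : ∀ a : ZMod 8, a * a =
      (if a = 1 then 1 else 0) + (if a = 3 then 1 else 0) + (if a = 5 then 1 else 0) +
        (if a = 7 then 1 else 0) + 4 * (if a = 2 then 1 else 0) +
        4 * (if a = 6 then 1 else 0) := by
    decide
  simp only [comp, mul_self_eq, sum_add_distrib, ← mul_sum, sum_boole, Nat.cast_add,
    Nat.cast_mul, Nat.cast_ofNat]

theorem selfOrthogonal_iff_generators
    (n : ℕ) (ι : Type*) [Fintype ι] (g : ι → (Fin n → ZMod 8)) :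
    SelfOrthogonal ((Submodule.span (ZMod 8) (Set.range g) :
        Submodule (ZMod 8) (Fin n → ZMod 8)) : Set (Fin n → ZMod 8)) ↔
      ((∀ i, ((comp (g i) 1 + comp (g i) 3 + comp (g i) 5 + comp (g i) 7 +
          4 * comp (g i) 2 + 4 * comp (g i) 6 : ℕ) : ZMod 8) = 0) ∧
       (∀ i j, i ≠ j → ∑ k, g i k * g j k = 0)) := by
  simp only [selfOrthogonal_span_iff, Set.forall_mem_range, ← sum_mul_self_eq_comp]
  refine ⟨fun h => ⟨fun i => h i i, fun i j _ => h i j⟩, fun ⟨hself, hne⟩ i j => ?_⟩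
  rcases eq_or_ne i j with rfl | hij
  · exact hself i
  · exact hne i j hij
end

section
/- Let C be a linear octonary code of length n that is self-orthogonal. Then C⁽⁴⁾ ⊆ (C⁽¹⁾)^⊥, where the dual is taken inside (Fin n → ZMod 2) with respect to the mod-2 inner product, and C⁽³⁾ ⊆ (C⁽²⁾)^⊥, where the dual is taken inside (Fin n → ZMod 4) with respect to the mod-4 inner product. -/
open Finset


theorem mu2_add (a b : ZMod 4) : mu2 (a + b) = mu2 a + mu2 b := by
  revert a b; decide

theorem mu4_add (a b : ZMod 2) : mu4 (a + b) = mu4 a + mu4 b := by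
  revert a b; decide

theorem mu2_eq_zero {a : ZMod 4} (h : mu2 a = 0) : a = 0 := by
  revert a; decide

theorem mu4_eq_zero {a : ZMod 2} (h : mu4 a = 0) : a = 0 := by
  revert a; decide

theorem mu2_mul_castHom (a : ZMod 4) (c : ZMod 8) :
    mu2 (a * ZMod.castHom (show (4 : ℕ) ∣ 8 by norm_num) (ZMod 4) c) = mu2 a * c := by
  revert a c; decide

theorem mu4_mul_castHom (a : ZMod 2) (c : ZMod 8) :
    mu4 (a * ZMod.castHom (show (2 : ℕ) ∣ 8 by norm_num) (ZMod 2) c) = mu4 a * c := by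
  revert a c; decide

theorem mu2_inner_red4 {n : ℕ} (v : Fin n → ZMod 4) (c : Fin n → ZMod 8) :
    mu2 (∑ i, v i * red4 c i) = ∑ i, mu2 (v i) * c i :=
  (map_sum (AddMonoidHom.mk' mu2 mu2_add) _ _).trans
    (sum_congr rfl fun i _ => mu2_mul_castHom (v i) (c i))

theorem mu4_inner_red2 {n : ℕ} (v : Fin n → ZMod 2) (c : Fin n → ZMod 8) :
    mu4 (∑ i, v i * red2 c i) = ∑ i, mu4 (v i) * c i :=
  (map_sum (AddMonoidHom.mk' mu4 mu4_add) _ _).trans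
    (sum_congr rfl fun i _ => mu4_mul_castHom (v i) (c i))

theorem torsion_subset_dual_reduction
    (n : ℕ) (C : Submodule (ZMod 8) (Fin n → ZMod 8))
    (hC : SelfOrthogonal (C : Set (Fin n → ZMod 8))) :
    codeC4 (C : Set (Fin n → ZMod 8)) ⊆ dualCode (codeC1 (C : Set (Fin n → ZMod 8))) ∧
    codeC3 (C : Set (Fin n → ZMod 8)) ⊆ dualCode (codeC2 (C : Set (Fin n → ZMod 8))) := by
  constructor
  · rintro v hv _ ⟨c, hc, rfl⟩
    exact mu4_eq_zero ((mu4_inner_red2 v c).trans (hC hv c hc))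
  · rintro v hv _ ⟨c, hc, rfl⟩
    exact mu2_eq_zero ((mu2_inner_red4 v c).trans (hC hv c hc))
end

section
/- Let C be a nonempty linear octonary code of length n. Then the covering radii of C with respect to the homogeneous, Lee, and Euclidean distances satisfy: r_HW(C) ≤ 2·r_E(C), r_E(C) ≤ 5·r_HW(C), r_L(C) ≤ r_E(C), and r_HW(C) ≤ 2·r_L(C). -/
open Finset

/-- Homogeneous weight on `ZMod 8`. -/
def wHW (x : ZMod 8) : ℕ := if x = 0 then 0 else if x = 4 then 4 else 2

/-- Lee weight on `ZMod 8`. -/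
def wL (x : ZMod 8) : ℕ := min x.val (8 - x.val)

/-- Euclidean weight on `ZMod 8`. -/
def wE (x : ZMod 8) : ℕ := min (x.val ^ 2) ((8 - x.val) ^ 2)

/-- The distance on `Fin n → ZMod 8` induced by a weight `w` on `ZMod 8`. -/
def distOf (w : ZMod 8 → ℕ) {n : ℕ} (x y : Fin n → ZMod 8) : ℕ := ∑ i, w (x i - y i)

/-- The covering radius of a code `C ⊆ α` with respect to a distance `d`:
the maximum over all `u` of the minimum distance from `u` to the code. -/
noncomputable def covRadius {α : Type*} [Fintype α] (d : α → α → ℕ) (C : Set α) : ℕ :=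
  ⨆ u : α, sInf {r | ∃ c ∈ C, r = d u c}

theorem distOf_le_mul_distOf {w w' : ZMod 8 → ℕ} {k : ℕ} (h : ∀ x, w x ≤ k * w' x) {n : ℕ}
    (x y : Fin n → ZMod 8) : distOf w x y ≤ k * distOf w' x y := by
  rw [distOf, distOf, Finset.mul_sum]
  exact Finset.sum_le_sum fun i _ => h _

theorem covRadius_le_mul_covRadius {α : Type*} [Fintype α] {d d' : α → α → ℕ} {k : ℕ}
    (h : ∀ x y, d x y ≤ k * d' x y) {C : Set α} (hC : C.Nonempty) :
    covRadius d C ≤ k * covRadius d' C := by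
  obtain ⟨c₀, hc₀⟩ := hC
  have : Nonempty α := ⟨c₀⟩
  refine ciSup_le fun u => ?_
  obtain ⟨c, hc, hmin⟩ : sInf {r | ∃ c ∈ C, r = d' u c} ∈ {r | ∃ c ∈ C, r = d' u c} :=
    Nat.sInf_mem ⟨_, c₀, hc₀, rfl⟩
  calc sInf {r | ∃ c ∈ C, r = d u c} ≤ d u c := Nat.sInf_le ⟨c, hc, rfl⟩
    _ ≤ k * d' u c := h u c
    _ = k * sInf {r | ∃ c ∈ C, r = d' u c} := by rw [hmin]
    _ ≤ k * covRadius d' C :=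
      Nat.mul_le_mul_left k <|
        le_ciSup (f := fun v => sInf {r | ∃ c ∈ C, r = d' v c}) (Set.finite_range _).bddAbove u

theorem covRadius_distOf_le_mul {w w' : ZMod 8 → ℕ} {k : ℕ} (h : ∀ x, w x ≤ k * w' x) {n : ℕ}
    {C : Set (Fin n → ZMod 8)} (hC : C.Nonempty) :
    covRadius (distOf w) C ≤ k * covRadius (distOf w') C :=
  covRadius_le_mul_covRadius (distOf_le_mul_distOf h) hC

theorem covRadius_comparisons
    (n : ℕ) (C : Submodule (ZMod 8) (Fin n → ZMod 8))
    (hC : (C : Set (Fin n → ZMod 8)).Nonempty) :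
    covRadius (distOf wHW) (C : Set (Fin n → ZMod 8)) ≤
      2 * covRadius (distOf wE) (C : Set (Fin n → ZMod 8)) ∧
    covRadius (distOf wE) (C : Set (Fin n → ZMod 8)) ≤
      5 * covRadius (distOf wHW) (C : Set (Fin n → ZMod 8)) ∧
    covRadius (distOf wL) (C : Set (Fin n → ZMod 8)) ≤
      covRadius (distOf wE) (C : Set (Fin n → ZMod 8)) ∧
    covRadius (distOf wHW) (C : Set (Fin n → ZMod 8)) ≤
      2 * covRadius (distOf wL) (C : Set (Fin n → ZMod 8)) := by
  refine ⟨covRadius_distOf_le_mul (by decide) hC, covRadius_distOf_le_mul (by decide) hC, ?_,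
    covRadius_distOf_le_mul (by decide) hC⟩
  simpa only [one_mul] using covRadius_distOf_le_mul (w := wL) (w' := wE) (k := 1) (by decide) hC
end

section
/- (Mattson bound) Let w : ZMod 8 → ℕ be any one of the homogeneous, Lee, or Euclidean weights, with induced coordinatewise-sum distance d and covering radius r_d. Let C be a nonempty linear octonary code of length n₀ + n₁ (identify (Fin (n₀+n₁) → ZMod 8) with (Fin n₀ → ZMod 8) × (Fin n₁ → ZMod 8)). Let C₀ ⊆ (Fin n₀ → ZMod 8) be the image of C under projection to the first n₀ coordinates, and let C₁ ⊆ (Fin n₁ → ZMod 8) be a nonempty linear code such that (0, c₁) ∈ C for every c₁ ∈ C₁. Then r_d(C) ≤ r_d(C₀) + r_d(C₁). Moreover, for any nonempty linear codes C₀ ⊆ (Fin n₀ → ZMod 8) and C₁ ⊆ (Fin n₁ → ZMod 8), the concatenation D = C₀ × C₁ = {(c₀, c₁) : c₀ ∈ C₀, c₁ ∈ C₁} satisfies r_d(D) ≥ r_d(C₀) + r_d(C₁). -/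
open Finset

/-- The distance induced by a weight `w` on the product space
`(Fin n₀ → ZMod 8) × (Fin n₁ → ZMod 8)` (identified with length `n₀ + n₁` vectors). -/
def prodDist (w : ZMod 8 → ℕ) {n₀ n₁ : ℕ}
    (x y : (Fin n₀ → ZMod 8) × (Fin n₁ → ZMod 8)) : ℕ :=
  distOf w x.1 y.1 + distOf w x.2 y.2

/-- The covering radius bounds the distance from every vector to some codeword. -/
theorem exists_dist_le_covRadius {α : Type*} [Fintype α] (d : α → α → ℕ) {C : Set α}
    (hC : C.Nonempty) (u : α) : ∃ c ∈ C, d u c ≤ covRadius d C := by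
  obtain ⟨c₀, hc₀⟩ := hC
  have hne : {r | ∃ c ∈ C, r = d u c}.Nonempty := ⟨_, c₀, hc₀, rfl⟩
  obtain ⟨c, hc, h⟩ := Nat.sInf_mem hne
  refine ⟨c, hc, h ▸ ?_⟩
  exact le_ciSup (f := fun u : α => sInf {r | ∃ c ∈ C, r = d u c})
    (Set.finite_range _).bddAbove u

/-- A uniform bound on distances to the code bounds the covering radius. -/
theorem covRadius_le {α : Type*} [Fintype α] [Nonempty α] {d : α → α → ℕ} {C : Set α} {k : ℕ}
    (h : ∀ u, ∃ c ∈ C, d u c ≤ k) : covRadius d C ≤ k := by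
  refine ciSup_le fun u => ?_
  obtain ⟨c, hc, hk⟩ := h u
  exact (Nat.sInf_le (s := {r | ∃ c ∈ C, r = d u c}) ⟨c, hc, rfl⟩).trans hk

/-- The covering radius is attained. -/
theorem exists_covRadius_le_dist {α : Type*} [Fintype α] [Nonempty α] (d : α → α → ℕ)
    (C : Set α) : ∃ u, ∀ c ∈ C, covRadius d C ≤ d u c := by
  obtain ⟨u, hu⟩ := exists_eq_ciSup_of_finite (f := fun u : α => sInf {r | ∃ c ∈ C, r = d u c})
  refine ⟨u, fun c hc => ?_⟩
  unfold covRadius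
  rw [← hu]
  exact Nat.sInf_le ⟨c, hc, rfl⟩

theorem distOf_sub_left (w : ZMod 8 → ℕ) {n : ℕ} (x y z : Fin n → ZMod 8) :
    distOf w (x - y) z = distOf w x (y + z) := by
  simp only [distOf, Pi.sub_apply, Pi.add_apply, sub_sub]

theorem mattson_bound
    (n₀ n₁ : ℕ) (w : ZMod 8 → ℕ) (hw : w = wHW ∨ w = wL ∨ w = wE)
    (C : Submodule (ZMod 8) ((Fin n₀ → ZMod 8) × (Fin n₁ → ZMod 8)))
    (C₁ : Submodule (ZMod 8) (Fin n₁ → ZMod 8))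
    (hC₁ : ∀ c₁ ∈ C₁, ((0, c₁) : (Fin n₀ → ZMod 8) × (Fin n₁ → ZMod 8)) ∈ C)
    (D₀ : Submodule (ZMod 8) (Fin n₀ → ZMod 8))
    (D₁ : Submodule (ZMod 8) (Fin n₁ → ZMod 8)) :
    covRadius (prodDist w) (C : Set ((Fin n₀ → ZMod 8) × (Fin n₁ → ZMod 8))) ≤
      covRadius (distOf w)
        ((C.map (LinearMap.fst (ZMod 8) (Fin n₀ → ZMod 8) (Fin n₁ → ZMod 8))) :
          Set (Fin n₀ → ZMod 8)) +
      covRadius (distOf w) (C₁ : Set (Fin n₁ → ZMod 8)) ∧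
    covRadius (distOf w) (D₀ : Set (Fin n₀ → ZMod 8)) +
      covRadius (distOf w) (D₁ : Set (Fin n₁ → ZMod 8)) ≤
      covRadius (prodDist w)
        ((D₀.prod D₁) : Set ((Fin n₀ → ZMod 8) × (Fin n₁ → ZMod 8))) := by
  constructor
  · refine covRadius_le fun u => ?_
    obtain ⟨c₀, hc₀, h₀⟩ := exists_dist_le_covRadius (distOf w)
      (C.map (LinearMap.fst (ZMod 8) (Fin n₀ → ZMod 8) (Fin n₁ → ZMod 8))).nonempty u.1
    obtain ⟨c, hc, rfl⟩ := hc₀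
    obtain ⟨c₁, hc₁, h₁⟩ := exists_dist_le_covRadius (distOf w) C₁.nonempty (u.2 - c.2)
    refine ⟨c + (0, c₁), C.add_mem hc (hC₁ c₁ hc₁), ?_⟩
    rw [distOf_sub_left] at h₁
    simpa [prodDist] using add_le_add h₀ h₁
  · obtain ⟨u₀, h₀⟩ := exists_covRadius_le_dist (distOf w) (D₀ : Set (Fin n₀ → ZMod 8))
    obtain ⟨u₁, h₁⟩ := exists_covRadius_le_dist (distOf w) (D₁ : Set (Fin n₁ → ZMod 8))
    obtain ⟨c, hc, h⟩ := exists_dist_le_covRadius (prodDist w) (D₀.prod D₁).nonempty (u₀, u₁)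
    exact (add_le_add (h₀ c.1 hc.1) (h₁ c.2 hc.2)).trans h
end

section
/- Let C be a linear octonary code of length n such that each of C⁽¹⁾, C⁽²⁾, C⁽³⁾, C⁽⁴⁾ contains a nonzero codeword, and let d₁, d₂, d₃, d₄ be the minimum Hamming weights (number of nonzero coordinates) of nonzero codewords of C⁽¹⁾, C⁽²⁾, C⁽³⁾, C⁽⁴⁾ respectively. Suppose d₁ ≥ 8, d₂ ≥ 18, 4·d₃ ≥ 25, and 16·d₄ ≥ 25, and set t = min{⌊d₁/8⌋, ⌊d₂/18⌋, ⌊4·d₃/25⌋, ⌊16·d₄/25⌋}. Then r_E(C) ≥ 9·t and r_HW(C) ≥ 2·t. -/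
open Finset


/-- The Hamming weight (number of nonzero coordinates) of a vector. -/
def hamWt {n q : ℕ} (x : Fin n → ZMod q) : ℕ := (univ.filter fun i => x i ≠ 0).card

lemma le_covRadius {α : Type*} [Fintype α] (d : α → α → ℕ) {C : Set α} (hC : C.Nonempty)
    {r : ℕ} (u : α) (h : ∀ c ∈ C, r ≤ d u c) : r ≤ covRadius d C := by
  refine le_trans (le_csInf ?_ ?_)
    (le_ciSup (f := fun u => sInf {r | ∃ c ∈ C, r = d u c}) (Set.finite_range _).bddAbove u)
  · obtain ⟨c, hc⟩ := hC
    exact ⟨_, c, hc, rfl⟩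
  · rintro _ ⟨c, hc, rfl⟩
    exact h c hc

/-- The vector equal to `3` on `T` and to `0` elsewhere. -/
def threeOn {n : ℕ} (T : Finset (Fin n)) : Fin n → ZMod 8 := fun i => if i ∈ T then 3 else 0

/-- A vector of `4 ℤ₈ⁿ` divided by `4`. -/
def quarter {n : ℕ} (c : Fin n → ZMod 8) : Fin n → ZMod 2 := fun i => if c i = 4 then 1 else 0

lemma mu4_quarter {n : ℕ} {c : Fin n → ZMod 8} (hc : red4 c = 0) :
    (fun i => mu4 (quarter c i)) = c := by
  funext i
  have hi : ZMod.castHom (show (4 : ℕ) ∣ 8 by norm_num) (ZMod 4) (c i) = 0 := congrFun hc i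
  simp only [quarter]
  generalize c i = x at hi
  revert x
  decide

lemma quarter_ne_zero {n : ℕ} {c : Fin n → ZMod 8} (hc : red4 c = 0) (h0 : c ≠ 0) :
    quarter c ≠ 0 := by
  intro h
  apply h0
  rw [← mu4_quarter hc, h]
  funext i
  simp [mu4]

/-- Summed form of a coordinatewise comparison between a weight of `threeOn T - c` and the
Hamming weight of a vector derived from `c`. -/
lemma mul_hamWt_le_distOf_threeOn {n q : ℕ} {w : ZMod 8 → ℕ} {T : Finset (Fin n)}
    {c : Fin n → ZMod 8} {v : Fin n → ZMod q} {a b : ℕ}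
    (hin : ∀ i, a ≤ w (3 - c i) + b ∨ v i = 0) (hout : ∀ i, a ≤ w (0 - c i) ∨ v i = 0) :
    a * hamWt v ≤ distOf w (threeOn T) c + b * T.card := by
  have h₁ : a * hamWt v = ∑ i, if v i ≠ 0 then a else 0 := by
    rw [← sum_filter, sum_const, smul_eq_mul, mul_comm, hamWt]
  have h₂ : b * T.card = ∑ i, if i ∈ T then b else 0 := by
    rw [← sum_filter, sum_const, smul_eq_mul, mul_comm, filter_mem_eq_inter, univ_inter]
  rw [h₁, h₂, distOf, ← sum_add_distrib]
  refine sum_le_sum fun i _ => ?_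
  have := hin i
  have := hout i
  by_cases hv : v i = 0
  · simp [hv]
  · by_cases hi : i ∈ T <;> simp_all [threeOn]

lemma distOf_threeOn_zero {n : ℕ} {w : ZMod 8 → ℕ} (hw : w 0 = 0) (T : Finset (Fin n)) :
    distOf w (threeOn T) 0 = w 3 * T.card := by
  have h : ∀ i, w (threeOn T i - (0 : Fin n → ZMod 8) i) = if i ∈ T then w 3 else 0 := by
    intro i
    by_cases hi : i ∈ T <;> simp [threeOn, hi, hw]
  rw [distOf, sum_congr rfl fun i _ => h i, ← sum_filter, sum_const, smul_eq_mul, mul_comm,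
    filter_mem_eq_inter, univ_inter]

lemma hamWt_red4_le_distOf_threeOn {n : ℕ} {w : ZMod 8 → ℕ} (hw : ∀ x, x ≠ 0 → 1 ≤ w x)
    (T : Finset (Fin n)) (c : Fin n → ZMod 8) :
    hamWt (red4 c) ≤ distOf w (threeOn T) c + T.card := by
  have := mul_hamWt_le_distOf_threeOn (w := w) (T := T) (c := c) (v := red4 c) (a := 1) (b := 1)
    (fun i => Or.inl (Nat.le_add_left _ _)) (fun i => ?_)
  · simpa using this
  · by_cases h : c i = 0
    · exact Or.inr (by simp [red4, h])
    · exact Or.inl (hw _ (by simpa using h))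

lemma hamWt_quarter_le_distOf_wE {n : ℕ} (T : Finset (Fin n)) (c : Fin n → ZMod 8) :
    16 * hamWt (quarter c) ≤ distOf wE (threeOn T) c + 15 * T.card := by
  apply mul_hamWt_le_distOf_threeOn <;>
  · intro i
    simp only [quarter]
    generalize c i = x
    revert x
    decide

lemma hamWt_quarter_le_distOf_wHW {n : ℕ} (T : Finset (Fin n)) (c : Fin n → ZMod 8) :
    4 * hamWt (quarter c) ≤ distOf wHW (threeOn T) c + 2 * T.card := by
  apply mul_hamWt_le_distOf_threeOn <;>
  · intro i
    simp only [quarter]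
    generalize c i = x
    revert x
    decide

theorem covRadius_lower_bound_from_torsion_distances
    (n : ℕ) (C : Submodule (ZMod 8) (Fin n → ZMod 8))
    (d₁ d₂ d₃ d₄ t : ℕ)
    (hd₁ : IsLeast {k | ∃ v ∈ codeC1 (C : Set (Fin n → ZMod 8)), v ≠ 0 ∧ hamWt v = k} d₁)
    (hd₂ : IsLeast {k | ∃ v ∈ codeC2 (C : Set (Fin n → ZMod 8)), v ≠ 0 ∧ hamWt v = k} d₂)
    (hd₃ : IsLeast {k | ∃ v ∈ codeC3 (C : Set (Fin n → ZMod 8)), v ≠ 0 ∧ hamWt v = k} d₃)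
    (hd₄ : IsLeast {k | ∃ v ∈ codeC4 (C : Set (Fin n → ZMod 8)), v ≠ 0 ∧ hamWt v = k} d₄)
    (h₁ : 8 ≤ d₁) (h₂ : 18 ≤ d₂) (h₃ : 25 ≤ 4 * d₃) (h₄ : 25 ≤ 16 * d₄)
    (ht : t = min (min (d₁ / 8) (d₂ / 18)) (min ((4 * d₃) / 25) ((16 * d₄) / 25))) :
    9 * t ≤ covRadius (distOf wE) (C : Set (Fin n → ZMod 8)) ∧
    2 * t ≤ covRadius (distOf wHW) (C : Set (Fin n → ZMod 8)) := by
  have hmin₂ : ∀ c ∈ C, red4 c ≠ 0 → 18 * t ≤ hamWt (red4 c) := by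
    intro c hc h
    have := hd₂.2 ⟨red4 c, ⟨c, hc, rfl⟩, h, rfl⟩
    omega
  have hmin₄ : ∀ c ∈ C, red4 c = 0 → c ≠ 0 → 25 * t ≤ 16 * hamWt (quarter c) := by
    intro c hc h h0
    have hmem : quarter c ∈ codeC4 (C : Set (Fin n → ZMod 8)) := by
      change (fun i => mu4 (quarter c i)) ∈ C
      rwa [mu4_quarter h]
    have := hd₄.2 ⟨quarter c, hmem, quarter_ne_zero h h0, rfl⟩
    omega
  have htn : t ≤ (univ : Finset (Fin n)).card := by
    obtain ⟨v, -, -, hv⟩ := hd₂.1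
    have : hamWt v ≤ (univ : Finset (Fin n)).card := card_filter_le _ _
    omega
  obtain ⟨T, -, hT⟩ := exists_subset_card_eq htn
  have hne : (C : Set (Fin n → ZMod 8)).Nonempty := ⟨0, C.zero_mem⟩
  constructor
  · refine le_covRadius _ hne (threeOn T) fun c hc => ?_
    by_cases h : red4 c = 0
    · by_cases h0 : c = 0
      · rw [h0, distOf_threeOn_zero (by decide), hT, show wE 3 = 9 by decide]
      · have := hmin₄ c hc h h0
        have := hamWt_quarter_le_distOf_wE T c
        omega
    · have := hmin₂ c hc h
      have := hamWt_red4_le_distOf_threeOn (w := wE) (by decide) T c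
      omega
  · refine le_covRadius _ hne (threeOn T) fun c hc => ?_
    by_cases h : red4 c = 0
    · by_cases h0 : c = 0
      · rw [h0, distOf_threeOn_zero (by decide), hT, show wHW 3 = 2 by decide]
      · have := hmin₄ c hc h h0
        have := hamWt_quarter_le_distOf_wHW T c
        omega
    · have := hmin₂ c hc h
      have := hamWt_red4_le_distOf_threeOn (w := wHW) (by decide) T c
      omega
end

section
/- Let n > 0 with 8 ∣ n, and let C_{α₁} ⊆ (Fin n → ZMod 8) be the repetition code consisting of all constant vectors, i.e. the Z8-submodule generated by the all-ones vector. Then 2·r_E(C_{α₁}) = 11·n and r_HW(C_{α₁}) = 2·n. -/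
open Finset

theorem sum_range_mul_natCast (m k : ℕ) [NeZero m] (f : ZMod m → ℕ) :
    ∑ i ∈ range (m * k), f (i : ZMod m) = k * ∑ x, f x := by
  have period : ∑ i ∈ range m, f (i : ZMod m) = ∑ x, f x :=
    sum_bij' (fun i _ => (i : ZMod m)) (fun x _ => x.val)
      (fun _ _ => mem_univ _) (fun x _ => mem_range.2 x.val_lt)
      (fun i hi => ZMod.val_cast_of_lt (mem_range.1 hi))
      (fun x _ => ZMod.natCast_zmod_val x) (fun _ _ => rfl)
  induction k with
  | zero => simp
  | succ k ih =>
    rw [Nat.mul_succ, sum_range_add, ih, Nat.succ_mul]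
    simp [period]

theorem mem_span_one_iff {n : ℕ} (c : Fin n → ZMod 8) :
    c ∈ Submodule.span (ZMod 8) {fun _ : Fin n => (1 : ZMod 8)} ↔ ∃ a, c = fun _ => a := by
  simp only [Submodule.mem_span_singleton, funext_iff, Pi.smul_apply, smul_eq_mul, mul_one,
    eq_comm]

theorem sum_distOf_const (w : ZMod 8 → ℕ) {n : ℕ} (u : Fin n → ZMod 8) :
    ∑ a, distOf w u (fun _ => a) = n * ∑ x, w x := by
  unfold distOf
  rw [sum_comm]
  have shift (i : Fin n) : ∑ a, w (u i - a) = ∑ x, w x := (Equiv.subLeft (u i)).sum_comp w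
  simp [shift]

theorem distOf_natCast_const (w : ZMod 8 → ℕ) (k : ℕ) (a : ZMod 8) :
    distOf w (fun i : Fin (8 * k) => ((i : ℕ) : ZMod 8)) (fun _ => a) = k * ∑ x, w x := by
  unfold distOf
  rw [Fin.sum_univ_eq_sum_range (fun i => w ((i : ZMod 8) - a)),
    sum_range_mul_natCast 8 k (fun x => w (x - a))]
  congr 1
  exact (Equiv.subRight a).sum_comp w

/-- Averaging over the code bounds the covering radius, and a word in which all symbols are
equally frequent attains the bound. -/
theorem covRadius_span_one (w : ZMod 8 → ℕ) (k : ℕ) :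
    covRadius (distOf w)
      (Submodule.span (ZMod 8) {fun _ : Fin (8 * k) => (1 : ZMod 8)} : Set (Fin (8 * k) → ZMod 8))
      = k * ∑ x, w x := by
  unfold covRadius
  simp only [SetLike.mem_coe, mem_span_one_iff]
  apply le_antisymm
  · refine ciSup_le fun u => ?_
    have average := card_nsmul_le_sum univ (fun a => distOf w u (fun _ => a)) _
      fun a _ => Nat.sInf_le (s := {r | ∃ c, (∃ a, c = fun _ => a) ∧ r = distOf w u c})
        ⟨fun _ => a, ⟨a, rfl⟩, rfl⟩
    rw [sum_distOf_const, card_univ, ZMod.card, smul_eq_mul, mul_assoc] at average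
    exact Nat.le_of_mul_le_mul_left average (by norm_num)
  · refine le_ciSup_of_le (Set.finite_range _).bddAbove (fun i => ((i : ℕ) : ZMod 8)) ?_
    refine le_csInf ⟨_, _, ⟨0, rfl⟩, rfl⟩ ?_
    rintro _ ⟨_, ⟨a, rfl⟩, rfl⟩
    exact (distOf_natCast_const w k a).ge

theorem covRadius_repetition_one
    (n : ℕ) (hn : 0 < n) (h8 : 8 ∣ n)
    (C : Submodule (ZMod 8) (Fin n → ZMod 8))
    (hC : C = Submodule.span (ZMod 8) {fun _ => (1 : ZMod 8)}) :
    2 * covRadius (distOf wE) (C : Set (Fin n → ZMod 8)) = 11 * n ∧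
    covRadius (distOf wHW) (C : Set (Fin n → ZMod 8)) = 2 * n := by
  obtain ⟨k, rfl⟩ := h8
  subst hC
  have sum_wE : ∑ x, wE x = 44 := by decide
  have sum_wHW : ∑ x, wHW x = 16 := by decide
  rw [covRadius_span_one, covRadius_span_one, sum_wE, sum_wHW]
  omega
end

section
/- Let n > 0 with 4 ∣ n, and let C_{α₂} ⊆ (Fin n → ZMod 8) be the repetition code generated by the all-twos vector, i.e. the set of constant vectors with constant value in {0, 2, 4, 6}. Then r_E(C_{α₂}) = 6·n and r_HW(C_{α₂}) = 2·n. -/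
open Finset

theorem covRadius_eq {α : Type*} [Fintype α] {d : α → α → ℕ} {C : Set α} {r : ℕ}
    (hle : ∀ u, ∃ c ∈ C, d u c ≤ r) (hge : ∃ u, ∀ c ∈ C, r ≤ d u c) :
    covRadius d C = r := by
  have hbound (u : α) : sInf {s | ∃ c ∈ C, s = d u c} ≤ r := by
    obtain ⟨c, hc, h⟩ := hle u
    exact le_trans (Nat.sInf_le ⟨c, hc, rfl⟩) h
  obtain ⟨u, hu⟩ := hge
  have : Nonempty α := ⟨u⟩
  refine le_antisymm (ciSup_le hbound) ?_
  have hru : r ≤ sInf {s | ∃ c ∈ C, s = d u c} := by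
    obtain ⟨c, hc, -⟩ := hle u
    refine le_csInf ⟨_, c, hc, rfl⟩ ?_
    rintro _ ⟨c, hc, rfl⟩
    exact hu c hc
  exact hru.trans (le_ciSup (f := fun u => sInf {s | ∃ c ∈ C, s = d u c})
    ⟨r, Set.forall_mem_range.2 hbound⟩ u)

theorem mem_span_const_two {n : ℕ} {c : Fin n → ZMod 8} :
    c ∈ Submodule.span (ZMod 8) {(fun _ => 2 : Fin n → ZMod 8)} ↔
      ∃ a : Fin 4, c = fun _ => 2 * (a.val : ZMod 8) := by
  rw [Submodule.mem_span_singleton]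
  constructor
  · rintro ⟨b, rfl⟩
    have h : ∀ b : ZMod 8, ∃ a : Fin 4, b * 2 = 2 * (a.val : ZMod 8) := by decide
    obtain ⟨a, ha⟩ := h b
    exact ⟨a, funext fun _ => ha⟩
  · rintro ⟨a, rfl⟩
    exact ⟨(a.val : ZMod 8), funext fun _ => mul_comm _ _⟩

/-- The average distance from `u` to the constant words of even value bounds the least one. -/
theorem exists_distOf_le {w : ZMod 8 → ℕ} {m : ℕ}
    (hw : ∀ x, ∑ a : Fin 4, w (x - 2 * (a.val : ZMod 8)) ≤ 4 * m)
    {n : ℕ} (u : Fin n → ZMod 8) :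
    ∃ c ∈ (Submodule.span (ZMod 8) {(fun _ => 2 : Fin n → ZMod 8)} : Set (Fin n → ZMod 8)),
      distOf w u c ≤ m * n := by
  have hsum : ∑ a : Fin 4, distOf w u (fun _ => 2 * (a.val : ZMod 8)) ≤
      ∑ _a : Fin 4, m * n := by
    unfold distOf
    rw [Finset.sum_comm]
    refine (Finset.sum_le_sum fun i _ => hw (u i)).trans (le_of_eq ?_)
    simp
    ring
  obtain ⟨a, -, ha⟩ := Finset.exists_le_of_sum_le Finset.univ_nonempty hsum
  exact ⟨_, mem_span_const_two.2 ⟨a, rfl⟩, ha⟩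

theorem sum_range_wE (a : Fin 4) (k : ℕ) :
    ∑ i ∈ Finset.range (4 * k), wE (2 * (i : ZMod 8) - 2 * (a.val : ZMod 8)) = 24 * k := by
  induction k with
  | zero => simp
  | succ k ih =>
    have hperiod (j : ℕ) : 2 * ((4 * k + j : ℕ) : ZMod 8) = 2 * (j : ZMod 8) := by
      have h8 : (8 : ZMod 8) = 0 := by decide
      push_cast
      linear_combination (k : ZMod 8) * h8
    have hblock : ∀ a : Fin 4, ∑ j ∈ Finset.range 4,
        wE (2 * (j : ZMod 8) - 2 * (a.val : ZMod 8)) = 24 := by decide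
    rw [Nat.mul_succ, Finset.sum_range_add, ih]
    simp only [hperiod]
    rw [hblock]
    ring

theorem covRadius_repetition_two
    (n : ℕ) (hn : 0 < n) (h4 : 4 ∣ n)
    (C : Submodule (ZMod 8) (Fin n → ZMod 8))
    (hC : C = Submodule.span (ZMod 8) {fun _ => (2 : ZMod 8)}) :
    covRadius (distOf wE) (C : Set (Fin n → ZMod 8)) = 6 * n ∧
    covRadius (distOf wHW) (C : Set (Fin n → ZMod 8)) = 2 * n := by
  subst hC
  constructor
  · refine covRadius_eq (exists_distOf_le (w := wE) (by decide)) ⟨fun i => 2 * (i.val : ZMod 8), ?_⟩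
    intro c hc
    obtain ⟨a, rfl⟩ := mem_span_const_two.1 hc
    obtain ⟨k, rfl⟩ := h4
    have h := sum_range_wE a k
    rw [← Fin.sum_univ_eq_sum_range
      (fun i => wE (2 * (i : ZMod 8) - 2 * (a.val : ZMod 8)))] at h
    simp only [distOf]
    omega
  · refine covRadius_eq (exists_distOf_le (w := wHW) (by decide)) ⟨fun _ => 1, ?_⟩
    intro c hc
    obtain ⟨a, rfl⟩ := mem_span_const_two.1 hc
    have hodd : ∀ a : Fin 4, wHW (1 - 2 * (a.val : ZMod 8)) = 2 := by decide
    simp only [distOf, hodd]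
    simp [mul_comm]
end

section
/- Let n > 0 with 2 ∣ n, and let C_{α₄} ⊆ (Fin n → ZMod 8) be the repetition code generated by the all-fours vector, i.e. the two-element code consisting of the zero vector and the constant vector with all entries 4. Then r_E(C_{α₄}) = 8·n and r_HW(C_{α₄}) = 2·n. -/
open Finset

theorem mem_span_const_four {n : ℕ} (c : Fin n → ZMod 8) :
    c ∈ Submodule.span (ZMod 8) {fun _ : Fin n => (4 : ZMod 8)} ↔
      c = (fun _ => 0) ∨ c = fun _ => 4 := by
  rw [Submodule.mem_span_singleton]
  constructor
  · rintro ⟨a, rfl⟩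
    have h : ∀ a : ZMod 8, a * 4 = 0 ∨ a * 4 = 4 := by decide
    exact (h a).imp (fun h => funext fun _ => h) (fun h => funext fun _ => h)
  · rintro (rfl | rfl)
    · exact ⟨0, zero_smul _ _⟩
    · exact ⟨1, one_smul _ _⟩

theorem sInf_dist_pair {α : Type*} (d : α → α → ℕ) (u a b : α) :
    sInf {r | ∃ c ∈ ({a, b} : Set α), r = d u c} = min (d u a) (d u b) := by
  have h : {r | ∃ c ∈ ({a, b} : Set α), r = d u c} = {d u a, d u b} := by
    ext r
    simp
  rw [h, csInf_pair]

theorem sum_range_two_mul_ite_even (m a b : ℕ) :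
    ∑ i ∈ range (2 * m), (if Even i then a else b) = m * (a + b) := by
  induction m with
  | zero => simp
  | succ m ih =>
    rw [show 2 * (m + 1) = 2 * m + 1 + 1 by ring, sum_range_succ, sum_range_succ, ih]
    simp only [even_two_mul, if_true, Nat.not_even_bit1, if_false]
    ring

/-- If `w` pairs `x` with `x - 4` up to total weight `2 * k`, then the covering radius of the
code `{0, 4}` in even length `n` is `k * n`. -/
theorem covRadius_span_const_four (w : ZMod 8 → ℕ) (k n : ℕ) (h2 : 2 ∣ n)
    (hw : ∀ x, w x + w (x - 4) ≤ 2 * k) (h0 : w 0 = 0) (h4 : w 4 = 2 * k) :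
    covRadius (distOf w)
      (Submodule.span (ZMod 8) {fun _ : Fin n => (4 : ZMod 8)} : Set (Fin n → ZMod 8)) =
      k * n := by
  have hC : (Submodule.span (ZMod 8) {fun _ : Fin n => (4 : ZMod 8)} : Set (Fin n → ZMod 8)) =
      {(fun _ => 0), (fun _ => 4)} := Set.ext mem_span_const_four
  simp only [covRadius, hC, sInf_dist_pair]
  have upper (u : Fin n → ZMod 8) :
      min (distOf w u fun _ => 0) (distOf w u fun _ => 4) ≤ k * n := by
    have h : distOf w u (fun _ => 0) + distOf w u (fun _ => 4) ≤ 2 * (k * n) := by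
      simp only [distOf, sub_zero, ← sum_add_distrib]
      calc ∑ i, (w (u i) + w (u i - 4)) ≤ ∑ _i : Fin n, 2 * k := sum_le_sum fun i _ => hw (u i)
        _ = 2 * (k * n) := by simp; ring
    omega
  refine le_antisymm (ciSup_le' upper) ?_
  obtain ⟨m, rfl⟩ := h2
  refine le_ciSup_of_le ⟨_, Set.forall_mem_range.2 upper⟩
    (fun i => if Even (i : ℕ) then 0 else 4) (le_min ?_ ?_)
  · have h (i : Fin (2 * m)) : w ((if Even (i : ℕ) then 0 else 4) - 0) =
        if Even (i : ℕ) then 0 else 2 * k := by split_ifs <;> simp [h0, h4]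
    simp only [distOf, h]
    rw [Fin.sum_univ_eq_sum_range (fun i => if Even i then 0 else 2 * k),
      sum_range_two_mul_ite_even]
    exact le_of_eq (by ring)
  · have h (i : Fin (2 * m)) : w ((if Even (i : ℕ) then 0 else 4) - 4) =
        if Even (i : ℕ) then 2 * k else 0 := by
      split_ifs
      · rw [show (0 - 4 : ZMod 8) = 4 by decide, h4]
      · rw [sub_self, h0]
    simp only [distOf, h]
    rw [Fin.sum_univ_eq_sum_range (fun i => if Even i then 2 * k else 0),
      sum_range_two_mul_ite_even]
    exact le_of_eq (by ring)

theorem covRadius_repetition_four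
    (n : ℕ) (hn : 0 < n) (h2 : 2 ∣ n)
    (C : Submodule (ZMod 8) (Fin n → ZMod 8))
    (hC : C = Submodule.span (ZMod 8) {fun _ => (4 : ZMod 8)}) :
    covRadius (distOf wE) (C : Set (Fin n → ZMod 8)) = 8 * n ∧
    covRadius (distOf wHW) (C : Set (Fin n → ZMod 8)) = 2 * n := by
  subst hC
  exact ⟨covRadius_span_const_four wE 8 n h2 (by decide) (by decide) (by decide),
    covRadius_span_const_four wHW 2 n h2 (by decide) (by decide) (by decide)⟩
end

section
/- Let m ≥ 4 be an even natural number, and let R^{1,m−2} ⊆ ((Fin (m−2) → ZMod 2) → ZMod 8) be the first-order Reed–Muller code over ZMod 8 of length 2^(m−2), namely R^{1,m−2} = {fun u => a + μ₄(Σᵢ b i · u i) : a ∈ ZMod 8, b ∈ (Fin (m−2) → ZMod 2)}, where the sum Σᵢ b i · u i is computed in ZMod 2 and μ₄ : ZMod 2 → ZMod 8 sends 0 to 0 and 1 to 4. Then r_HW(R^{1,m−2}) = 2^(m−1) − 2^(m/2 − 1). -/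
open Finset

/-- The distance induced by a weight `w` on `ι → ZMod 8` for a finite index type `ι`. -/
def distOn {ι : Type*} [Fintype ι] (w : ZMod 8 → ℕ) (x y : ι → ZMod 8) : ℕ :=
  ∑ i, w (x i - y i)

/-- The first-order Reed–Muller code over `ZMod 8` of length `2^(m-2)`. -/
def reedMuller1 (m : ℕ) : Set ((Fin (m - 2) → ZMod 2) → ZMod 8) :=
  {f | ∃ (a : ZMod 8) (b : Fin (m - 2) → ZMod 2),
    f = fun u => a + mu4 (∑ i, b i * u i)}

/-- The homogeneous weight is `2 - 2 * signHW`: `signHW` is `1` at `0`, `-1` at `4`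
and `0` elsewhere. -/
def signHW (x : ZMod 8) : ℤ := if x = 0 then 1 else if x = 4 then -1 else 0

/-- The nontrivial sign character of `ZMod 2`. -/
def signChar (v : ZMod 2) : ℤ := if v = 0 then 1 else -1

/-- The Walsh transform of an integer-valued function on `Fin n → ZMod 2`. -/
def walsh {n : ℕ} (f : (Fin n → ZMod 2) → ℤ) (b : Fin n → ZMod 2) : ℤ :=
  ∑ x, f x * signChar (∑ i, b i * x i)

theorem wHW_sub_add_mu4 (x a : ZMod 8) (v : ZMod 2) :
    (wHW (x - (a + mu4 v)) : ℤ) = 2 - 2 * (signHW (x - a) * signChar v) := by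
  revert x a v; decide

theorem signHW_sub_add_four (x a : ZMod 8) : signHW (x - (a + 4)) = -signHW (x - a) := by
  revert x a; decide

theorem signHW_add_mu4_sub (x a : ZMod 8) (v : ZMod 2) :
    signHW (x + mu4 v - a) = signHW (x - a) * signChar v := by
  revert x a v; decide

theorem sum_signHW_sq (x : ZMod 8) : ∑ a, signHW (x - a) ^ 2 = 2 := by
  revert x; decide

theorem signChar_add (v w : ZMod 2) : signChar (v + w) = signChar v * signChar w := by
  revert v w; decide

theorem distOn_wHW_eq {n : ℕ} (u : (Fin n → ZMod 2) → ZMod 8) (a : ZMod 8)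
    (b : Fin n → ZMod 2) :
    (distOn wHW u (fun x => a + mu4 (∑ i, b i * x i)) : ℤ) =
      2 * 2 ^ n - 2 * walsh (fun x => signHW (u x - a)) b := by
  simp only [distOn, walsh, Nat.cast_sum, wHW_sub_add_mu4, sum_sub_distrib, mul_sum]
  simp [mul_comm]

theorem sum_fin_succ_pi {n : ℕ} (g : (Fin (n + 1) → ZMod 2) → ℤ) :
    ∑ x, g x = ∑ x : Fin n → ZMod 2, (g (Fin.cons 0 x) + g (Fin.cons 1 x)) := by
  rw [← (Fin.consEquiv fun _ : Fin (n + 1) => ZMod 2).sum_comp, Fintype.sum_prod_type,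
    sum_add_distrib]
  exact Fin.sum_univ_two _

theorem walsh_succ {n : ℕ} (f : (Fin (n + 1) → ZMod 2) → ℤ) (c : ZMod 2)
    (b : Fin n → ZMod 2) :
    walsh f (Fin.cons c b) =
      walsh (fun x => f (Fin.cons 0 x)) b + signChar c * walsh (fun x => f (Fin.cons 1 x)) b := by
  simp only [walsh, sum_fin_succ_pi, Fin.sum_univ_succ, Fin.cons_zero, Fin.cons_succ,
    signChar_add, mul_sum, ← sum_add_distrib]
  refine sum_congr rfl fun x _ => ?_
  simp [signChar]

theorem walsh_neg {n : ℕ} (f : (Fin n → ZMod 2) → ℤ) (b : Fin n → ZMod 2) :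
    walsh (fun x => -f x) b = -walsh f b := by
  simp [walsh]

theorem sum_walsh_sq {n : ℕ} (f : (Fin n → ZMod 2) → ℤ) :
    ∑ b, walsh f b ^ 2 = 2 ^ n * ∑ x, f x ^ 2 := by
  induction n with
  | zero => simp [walsh, signChar]
  | succ n ih =>
    rw [sum_fin_succ_pi, sum_fin_succ_pi, sum_add_distrib (f := fun x => f (Fin.cons 0 x) ^ 2),
      pow_succ, mul_assoc, mul_left_comm, mul_add, ← ih fun x => f (Fin.cons 0 x),
      ← ih fun x => f (Fin.cons 1 x), ← sum_add_distrib, mul_sum]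
    refine sum_congr rfl fun b _ => ?_
    simp only [walsh_succ]
    simp [signChar]
    ring

theorem exists_two_pow_le_two_mul_walsh (h : ℕ) (u : (Fin (2 * h) → ZMod 2) → ZMod 8) :
    ∃ a b, (2 : ℤ) ^ h ≤ 2 * walsh (fun x => signHW (u x - a)) b := by
  by_contra! H
  have habs (a b) : (2 * walsh (fun x => signHW (u x - a)) b) ^ 2 < ((2 : ℤ) ^ h) ^ 2 := by
    have h4 := H (a + 4) b
    simp only [signHW_sub_add_four, walsh_neg] at h4
    exact sq_lt_sq' (by linarith) (H a b)
  have hlt : ∑ a : ZMod 8, ∑ b, (2 * walsh (fun x => signHW (u x - a)) b) ^ 2 <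
      ∑ _a : ZMod 8, ∑ _b : Fin (2 * h) → ZMod 2, ((2 : ℤ) ^ h) ^ 2 :=
    sum_lt_sum_of_nonempty univ_nonempty fun a _ =>
      sum_lt_sum_of_nonempty univ_nonempty fun b _ => habs a b
  simp only [mul_pow, ← mul_sum, sum_walsh_sq] at hlt
  rw [sum_comm] at hlt
  simp only [sum_signHW_sq] at hlt
  simp [ZMod.card, ← pow_mul, mul_comm h 2] at hlt
  linarith

theorem exists_walsh_flat (k : ℕ) :
    ∃ u : (Fin (2 * k + 2) → ZMod 2) → ZMod 8,
      ∀ a b, walsh (fun x => signHW (u x - a)) b ^ 2 = (2 ^ k) ^ 2 := by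
  induction k with
  | zero =>
    refine ⟨fun x => ((x 0).val + 2 * (x 1).val : ℕ), ?_⟩
    decide
  | succ k ih =>
    obtain ⟨u, hu⟩ := ih
    refine ⟨fun x : Fin (2 * k + 2 + 1 + 1) → ZMod 2 =>
      u (Fin.tail (Fin.tail x)) + mu4 (x 0 * x 1),
      fun a (b : Fin (2 * k + 2 + 1 + 1) → ZMod 2) => ?_⟩
    have hc := hu a (Fin.tail (Fin.tail b))
    rw [← Fin.cons_self_tail b, ← Fin.cons_self_tail (Fin.tail b)]
    generalize Fin.tail (Fin.tail b) = b' at *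
    generalize Fin.tail b 0 = q
    generalize b 0 = p
    have hmul (r s : ZMod 2) : walsh (fun x => signHW (u x + mu4 (r * s) - a)) b' =
        walsh (fun x => signHW (u x - a)) b' * signChar (r * s) := by
      simp only [signHW_add_mu4_sub, walsh, sum_mul, mul_right_comm]
    rw [walsh_succ, walsh_succ, walsh_succ]
    change (walsh (fun x => signHW (u x + mu4 (0 * 0) - a)) b' +
      signChar q * walsh (fun x => signHW (u x + mu4 (0 * 1) - a)) b' +
      signChar p * (walsh (fun x => signHW (u x + mu4 (1 * 0) - a)) b' +
        signChar q * walsh (fun x => signHW (u x + mu4 (1 * 1) - a)) b')) ^ 2 = _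
    simp only [hmul]
    simp only [signChar, mul_zero, mul_one, if_true, one_ne_zero, if_false]
    rw [pow_succ (2 : ℤ) k, mul_pow _ (2 : ℤ), ← hc]
    split_ifs <;> ring

/-- For even length exponents, the covering radius follows from Parseval's identity (upper bound)
and the existence of a word with flat Walsh spectra (lower bound). -/
theorem covRadius_reedMuller1
    (m : ℕ) (hm : 4 ≤ m) (hme : Even m) :
    covRadius (distOn wHW) (reedMuller1 m) = 2 ^ (m - 1) - 2 ^ (m / 2 - 1) := by
  obtain ⟨k, rfl⟩ : ∃ k, m = 2 * (k + 1) + 2 := by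
    obtain ⟨j, rfl⟩ := hme
    exact ⟨j - 2, by omega⟩
  have hexp : (2 * (k + 1) + 2) / 2 - 1 = k + 1 := by omega
  rw [hexp, show 2 * (k + 1) + 2 - 1 = 2 * (k + 1) + 1 by omega]
  have hle : 2 ^ (k + 1) ≤ 2 ^ (2 * (k + 1) + 1) := Nat.pow_le_pow_right two_pos (by omega)
  have hupper (u : (Fin (2 * (k + 1)) → ZMod 2) → ZMod 8) :
      sInf {r | ∃ c ∈ reedMuller1 (2 * (k + 1) + 2), r = distOn wHW u c} ≤
        2 ^ (2 * (k + 1) + 1) - 2 ^ (k + 1) := by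
    obtain ⟨a, b, hab⟩ := exists_two_pow_le_two_mul_walsh (k + 1) u
    refine le_trans (Nat.sInf_le ⟨_, ⟨a, b, rfl⟩, rfl⟩) ?_
    zify [hle]
    have := distOn_wHW_eq u a b
    refine (le_of_eq this).trans ?_
    rw [pow_succ (2 : ℤ) (2 * (k + 1))]
    linarith
  refine le_antisymm (ciSup_le' hupper) ?_
  obtain ⟨u, hu⟩ := exists_walsh_flat k
  refine le_trans ?_ (le_ciSup (f := fun u => sInf {r | ∃ c ∈ reedMuller1 (2 * (k + 1) + 2),
    r = distOn wHW u c}) ⟨_, Set.forall_mem_range.2 hupper⟩ u)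
  refine le_csInf ⟨_, _, ⟨0, 0, rfl⟩, rfl⟩ ?_
  rintro _ ⟨_, ⟨a, b, rfl⟩, rfl⟩
  zify [hle]
  have hd := distOn_wHW_eq u a b
  refine le_trans ?_ (ge_of_eq hd)
  have hw := abs_le_of_sq_le_sq (hu a b).le (by positivity)
  have e1 : (2 : ℤ) ^ (2 * (k + 1) + 1) = 2 * 2 ^ (2 * k + 2) := by ring
  rw [e1, pow_succ (2 : ℤ) k]
  linarith [le_abs_self (walsh (fun x => signHW (u x - a)) b)]
end
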